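/- Counting estimate with a free sum variable (the estimate (CC2) in Remark 3.4): Let 1 < α ≤ 2 and let k ≥ 3 be an integer. For every choice of signs ε_sum, ε_1, …, ε_k ∈ {−1, +1} there exists a constant C = C(α, k) > 0 such that for all dyadic numbers N_sum, N_1, …, N_{k−1} ≥ 1 and every ζ ∈ ℝ, the cardinality of the set { (n_sum, n_1, …, n_{k−1}) ∈ (ℤ³)^k : |n_sum| ∼ N_sum, |n_j| ∼ N_j for 1 ≤ j ≤ k−1, and |ε_sum·⟪n_sum⟫ + Σ_{j=1}^{k−1} ε_j·⟪n_j⟫ + ε_k·⟪n_sum − Σ_{j=1}^{k−1} n_j⟫ − ζ| ≤ 1 } is at most C · (max_(2){N_sum, N_1, …, N_{k−1}})^{−1} · N_sum³ · Π_{j=1}^{k−1} N_j³. -/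

import Mathlib

noncomputable section

open scoped BigOperators

/-- Japanese bracket of a real number: `⟨x⟩ = (1 + x²)^{1/2}`. -/
def rjb (x : ℝ) : ℝ := Real.sqrt (1 + x ^ 2)

/-- Euclidean norm of a lattice point in `ℤ³`. -/
def znorm (n : Fin 3 → ℤ) : ℝ := Real.sqrt (∑ i, ((n i : ℝ)) ^ 2)

/-- Japanese bracket `⟨n⟩ = (1 + |n|²)^{1/2}` of a lattice point in `ℤ³`. -/
def jb (n : Fin 3 → ℤ) : ℝ := Real.sqrt (1 + ∑ i, ((n i : ℝ)) ^ 2)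

/-- The modified bracket `⟪n⟫ = (⟨n⟩^{2α} − 1/4)^{1/2}`. -/
def jbb (α : ℝ) (n : Fin 3 → ℤ) : ℝ := Real.sqrt (jb n ^ (2 * α) - 1 / 4)

/-- Dyadic numbers `2^j`, `j ≥ 0`. -/
def IsDyadic (N : ℝ) : Prop := ∃ j : ℕ, N = 2 ^ j

/-- `|n| ∼ N` for a dyadic number `N`: `N/2 < |n| ≤ N` if `N ≥ 2`, and `|n| ≤ 1` if `N = 1`. -/
def SimFreq (N : ℝ) (n : Fin 3 → ℤ) : Prop :=
  (2 ≤ N ∧ N / 2 < znorm n ∧ znorm n ≤ N) ∨ (N < 2 ∧ znorm n ≤ 1)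

/-- `x` is a sign `±1`. -/
def IsSign (x : ℝ) : Prop := x = 1 ∨ x = -1

open Classical in
/-- Real-valued indicator of a proposition. -/
def ind (p : Prop) : ℝ := if p then 1 else 0

/-- The second largest entry of a finite tuple of reals (with multiplicity). -/
def secondMax {k : ℕ} (Nv : Fin k → ℝ) : ℝ :=
  sSup {x : ℝ | ∃ i j : Fin k, i ≠ j ∧ x = min (Nv i) (Nv j)}


section Analysis

variable {E : Type*} [NormedAddCommGroup E]

/-- The bracket power `(1 + ‖x‖²)^{α/2}`. -/
def bracketPow (α : ℝ) (x : E) : ℝ := (1 + ‖x‖ ^ 2) ^ (α / 2)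

/-- The radial factor of the gradient of `bracketPow α`, up to the factor `α`. -/
def radialWeight (α : ℝ) (x : E) : ℝ := (1 + ‖x‖ ^ 2) ^ (α / 2 - 1)

lemma radialWeight_pos (α : ℝ) (x : E) : 0 < radialWeight α x := by
  unfold radialWeight; positivity

lemma bracketPow_neg (α : ℝ) (x : E) : bracketPow α (-x) = bracketPow α x := by
  simp [bracketPow]

lemma radialWeight_anti {α : ℝ} (hα₂ : α ≤ 2) {x y : E} (h : ‖x‖ ≤ ‖y‖) :
    radialWeight α y ≤ radialWeight α x := by
  unfold radialWeight
  apply Real.rpow_le_rpow_of_nonpos (by positivity) _ (by linarith)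
  gcongr

lemma inv_one_add_le_radialWeight {α : ℝ} (hα₁ : 1 < α) (x : E) :
    (1 + ‖x‖)⁻¹ ≤ radialWeight α x := by
  have h1 : (1 + ‖x‖ ^ 2) ^ (-(1 / 2) : ℝ) ≤ radialWeight α x := by
    unfold radialWeight
    apply Real.rpow_le_rpow_of_exponent_le
    · nlinarith [sq_nonneg ‖x‖]
    · linarith
  refine le_trans ?_ h1
  rw [Real.rpow_neg (by positivity), ← Real.sqrt_eq_rpow]
  apply inv_anti₀ (by positivity)
  rw [Real.sqrt_le_left (by positivity)]
  nlinarith [norm_nonneg x]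

lemma norm_mul_radialWeight_le {α : ℝ} (hα₁ : 1 < α) (hα₂ : α ≤ 2) {x y : E}
    (h : ‖x‖ ≤ ‖y‖) :
    ‖x‖ * radialWeight α x ≤ radialWeight α y * ((α - 1) * ‖x‖ + (2 - α) * ‖y‖) := by
  rcases (norm_nonneg x).eq_or_lt with hx | hx
  · rw [← hx]
    have := radialWeight_pos α y
    have h2 : 0 ≤ 2 - α := by linarith
    simp only [zero_mul, mul_zero, zero_add]
    positivity
  have hy : 0 < ‖y‖ := hx.trans_le h
  have hU : 0 < 1 + ‖x‖ ^ 2 := by positivity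
  have hV : 0 < 1 + ‖y‖ ^ 2 := by positivity
  have amgm := Real.geom_mean_le_arith_mean2_weighted (w₁ := α - 1) (w₂ := 2 - α)
    (by linarith) (by linarith) hx.le hy.le (by ring)
  have hVU : (1 + ‖y‖ ^ 2) ^ (1 - α / 2) ≤
      (1 + ‖x‖ ^ 2) ^ (1 - α / 2) * (‖y‖ / ‖x‖) ^ (2 - α) := by
    have e1 : (‖y‖ / ‖x‖) ^ (2 - α) = ((‖y‖ / ‖x‖) ^ 2) ^ (1 - α / 2) := by
      rw [← Real.rpow_natCast, ← Real.rpow_mul (by positivity)]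
      congr 1; push_cast; ring
    rw [e1, ← Real.mul_rpow (by positivity) (by positivity)]
    apply Real.rpow_le_rpow hV.le _ (by linarith)
    rw [div_pow, mul_div_assoc', le_div_iff₀ (by positivity)]
    nlinarith [pow_le_pow_left₀ hx.le h 2]
  have hsplit : ‖x‖ * (‖y‖ / ‖x‖) ^ (2 - α) = ‖x‖ ^ (α - 1) * ‖y‖ ^ (2 - α) := by
    have : ‖x‖ ^ (α - 1) * ‖x‖ ^ (2 - α) = ‖x‖ := by
      rw [← Real.rpow_add hx, show α - 1 + (2 - α) = 1 by ring, Real.rpow_one]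
    rw [Real.div_rpow hy.le hx.le, mul_div_assoc', div_eq_iff (Real.rpow_pos_of_pos hx _).ne']
    linear_combination -‖y‖ ^ (2 - α) * this
  have wx : radialWeight α x = ((1 + ‖x‖ ^ 2) ^ (1 - α / 2))⁻¹ := by
    rw [radialWeight, ← Real.rpow_neg hU.le]; congr 1; ring
  have wy : radialWeight α y = ((1 + ‖y‖ ^ 2) ^ (1 - α / 2))⁻¹ := by
    rw [radialWeight, ← Real.rpow_neg hV.le]; congr 1; ring
  rw [wx, wy]
  have pU := Real.rpow_pos_of_pos hU (1 - α / 2)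
  have pV := Real.rpow_pos_of_pos hV (1 - α / 2)
  rw [← div_eq_mul_inv, div_le_iff₀ pU, mul_assoc, inv_mul_eq_div, le_div_iff₀ pV]
  calc ‖x‖ * (1 + ‖y‖ ^ 2) ^ (1 - α / 2)
      ≤ ‖x‖ * ((1 + ‖x‖ ^ 2) ^ (1 - α / 2) * (‖y‖ / ‖x‖) ^ (2 - α)) := by gcongr
    _ = (‖x‖ ^ (α - 1) * ‖y‖ ^ (2 - α)) * (1 + ‖x‖ ^ 2) ^ (1 - α / 2) := by
        rw [← hsplit]; ring
    _ ≤ _ := by gcongr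

variable [InnerProductSpace ℝ E]

/-- The gradient of `bracketPow α`, up to the factor `α`. -/
def bracketGrad (α : ℝ) (x : E) : E := radialWeight α x • x

/-- `v` and `e` enclose a small angle: `⟨v, e⟩ ≥ (1 - η) ‖v‖ ‖e‖`. -/
def InCone (η : ℝ) (v e : E) : Prop := (1 - η) * (‖v‖ * ‖e‖) ≤ inner ℝ v e

lemma bracketGrad_sub_bounds_of_norm_le {α : ℝ} (hα₁ : 1 < α) (hα₂ : α ≤ 2) {x y : E}
    (h : ‖x‖ ≤ ‖y‖) :
    (α - 1) * radialWeight α y * ‖y - x‖ ^ 2 ≤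
        inner ℝ (y - x) (bracketGrad α y - bracketGrad α x) ∧
      ‖bracketGrad α y - bracketGrad α x‖ ≤ 2 * radialWeight α y * ‖y - x‖ := by
  set γ := radialWeight α y with hγ
  set δ := radialWeight α x - γ with hδ
  have γpos : 0 < γ := radialWeight_pos α y
  have δnn : 0 ≤ δ := sub_nonneg.2 (radialWeight_anti hα₂ h)
  have key : δ * ‖x‖ ≤ (2 - α) * γ * (‖y‖ - ‖x‖) := by
    have := norm_mul_radialWeight_le hα₁ hα₂ h
    rw [← hγ] at this
    rw [hδ]; linarith
  have hle : ‖y‖ - ‖x‖ ≤ ‖y - x‖ := norm_sub_norm_le y x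
  have key2 : δ * ‖x‖ ≤ (2 - α) * γ * ‖y - x‖ :=
    key.trans (mul_le_mul_of_nonneg_left hle (mul_nonneg (by linarith) γpos.le))
  have hD : bracketGrad α y - bracketGrad α x = γ • (y - x) - δ • x := by
    simp only [bracketGrad, hδ, ← hγ, smul_sub, sub_smul]; abel
  rw [hD]
  constructor
  · rw [inner_sub_right, inner_smul_right, inner_smul_right, real_inner_self_eq_norm_sq]
    have h1 : inner ℝ (y - x) x ≤ ‖y - x‖ * ‖x‖ := real_inner_le_norm _ _
    have h2 : δ * inner ℝ (y - x) x ≤ ‖y - x‖ * ((2 - α) * γ * ‖y - x‖) := by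
      calc δ * inner ℝ (y - x) x ≤ δ * (‖y - x‖ * ‖x‖) := by gcongr
        _ = ‖y - x‖ * (δ * ‖x‖) := by ring
        _ ≤ _ := by gcongr
    linarith
  · refine (norm_sub_le _ _).trans ?_
    rw [norm_smul, norm_smul, Real.norm_of_nonneg γpos.le, Real.norm_of_nonneg δnn]
    have : (2 - α) * γ * ‖y - x‖ ≤ 1 * γ * ‖y - x‖ := by gcongr; linarith
    linarith

/-- The gradient of `bracketPow α` is strongly monotone and Lipschitz, with comparable constants. -/
lemma exists_bracketGrad_sub_bounds {α : ℝ} (hα₁ : 1 < α) (hα₂ : α ≤ 2) {x y : E} {L : ℝ}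
    (hx : ‖x‖ ≤ L) (hy : ‖y‖ ≤ L) :
    ∃ γ, (1 + L)⁻¹ ≤ γ ∧
      (α - 1) * γ * ‖y - x‖ ^ 2 ≤ inner ℝ (y - x) (bracketGrad α y - bracketGrad α x) ∧
      ‖bracketGrad α y - bracketGrad α x‖ ≤ 2 * γ * ‖y - x‖ := by
  have bound : ∀ z : E, ‖z‖ ≤ L → (1 + L)⁻¹ ≤ radialWeight α z := fun z hz =>
    (inv_anti₀ (by positivity) (by linarith)).trans (inv_one_add_le_radialWeight hα₁ z)
  rcases le_total ‖x‖ ‖y‖ with h | h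
  · exact ⟨_, bound y hy, bracketGrad_sub_bounds_of_norm_le hα₁ hα₂ h⟩
  · refine ⟨_, bound x hx, ?_⟩
    have := bracketGrad_sub_bounds_of_norm_le hα₁ hα₂ h
    rwa [← neg_sub y x, ← neg_sub (bracketGrad α y), inner_neg_neg, norm_neg, norm_neg] at this

lemma inner_bracketGrad_sub_ge {α : ℝ} (hα₁ : 1 < α) (hα₂ : α ≤ 2) {x y v : E} {L : ℝ}
    (hx : ‖x‖ ≤ L) (hy : ‖y‖ ≤ L) (hv : InCone ((α - 1) ^ 2 / 32) v (y - x)) :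
    (α - 1) / 2 * ‖v‖ * (‖y - x‖ / (1 + L)) ≤
      inner ℝ v (bracketGrad α y - bracketGrad α x) := by
  obtain ⟨γ, hγ, hmono, hlip⟩ := exists_bracketGrad_sub_bounds hα₁ hα₂ hx hy
  have hL : 0 < 1 + L := by linarith [norm_nonneg x]
  have γpos : 0 < γ := (inv_pos.2 hL).trans_le hγ
  set D := bracketGrad α y - bracketGrad α x
  set e := y - x
  rcases (norm_nonneg e).eq_or_lt with he | he
  · have hD : D = 0 := by
      rw [← norm_le_zero_iff]; simpa [← he] using hlip
    simp [hD, ← he]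
  set p := ‖v‖
  set q := ‖e‖
  have hp : 0 ≤ p := norm_nonneg v
  have hw : ‖q • v - p • e‖ ≤ (α - 1) / 4 * (p * q) := by
    apply abs_le_of_sq_le_sq' _ (by have : 0 < α - 1 := by linarith
                                    positivity) |>.2
    have : ‖q • v - p • e‖ ^ 2 = 2 * p ^ 2 * q ^ 2 - 2 * (p * q) * inner ℝ v e := by
      rw [norm_sub_sq_real, norm_smul, norm_smul, inner_smul_left, inner_smul_right,
        Real.norm_of_nonneg hp, Real.norm_of_nonneg he.le]
      simp only [conj_trivial]
      ring
    rw [this]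
    have := mul_le_mul_of_nonneg_left hv (show 0 ≤ 2 * (p * q) by positivity)
    nlinarith
  have h1 : q * inner ℝ v D = p * inner ℝ e D + inner ℝ (q • v - p • e) D := by
    rw [inner_sub_left (q • v), real_inner_smul_left, real_inner_smul_left]; ring
  have h2 : -(((α - 1) / 4 * (p * q)) * (2 * γ * q)) ≤ inner ℝ (q • v - p • e) D := by
    have := neg_le_of_abs_le (abs_real_inner_le_norm (q • v - p • e) D)
    have h3 : ‖q • v - p • e‖ * ‖D‖ ≤ ((α - 1) / 4 * (p * q)) * (2 * γ * q) :=
      mul_le_mul hw hlip (norm_nonneg _) ((norm_nonneg _).trans hw)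
    linarith
  have h4 : (α - 1) / 2 * p * (γ * q) ≤ inner ℝ v D := by
    refine le_of_mul_le_mul_left ?_ he
    have := mul_le_mul_of_nonneg_left hmono hp
    rw [h1]; nlinarith
  refine le_trans ?_ h4
  have : 0 ≤ (α - 1) / 2 * p := mul_nonneg (by linarith) hp
  rw [div_eq_inv_mul ‖y - x‖]
  exact mul_le_mul_of_nonneg_left (mul_le_mul_of_nonneg_right hγ he.le) this

lemma hasDerivAt_bracketPow_line (α : ℝ) (x v : E) (t : ℝ) :
    HasDerivAt (fun t : ℝ => bracketPow α (x + t • v))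
      (α * inner ℝ v (bracketGrad α (x + t • v))) t := by
  have h1 : HasDerivAt (fun t : ℝ => x + t • v) v t := by
    simpa using ((hasDerivAt_id t).smul_const v).const_add x
  have h2 := (h1.norm_sq.const_add 1).rpow_const (p := α / 2) (Or.inl (by positivity))
  refine h2.congr_deriv ?_
  rw [bracketGrad, inner_smul_right, real_inner_comm, radialWeight]
  ring

/-- Lower bound for the growth of `x ↦ ⟨x + c⟩^α - σ ⟨x⟩^α` (with `σ = ±1`) along a segment whose
direction is close to that of `x + c - σ x`. -/
lemma bracketPow_phase_growth {α : ℝ} (hα₁ : 1 < α) (hα₂ : α ≤ 2) {σ : ℝ} (hσ : σ = 1 ∨ σ = -1)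
    {x c v : E} {s B r : ℝ} (hs : 0 ≤ s) (hB : 1 ≤ B) (hr : 0 < r) (hx : ‖x‖ ≤ B)
    (hx' : ‖x + s • v‖ ≤ B)
    (hc : InCone ((α - 1) ^ 2 / 32) v (x + c - σ • x))
    (hc' : InCone ((α - 1) ^ 2 / 32) v (x + s • v + c - σ • (x + s • v)))
    (he : r ≤ ‖x + c - σ • x‖) (he' : r ≤ ‖x + s • v + c - σ • (x + s • v)‖) :
    (α - 1) / 2 * (r / (4 * B + r)) * (s * ‖v‖) ≤
      (bracketPow α (x + s • v + c) - σ * bracketPow α (x + s • v)) -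
        (bracketPow α (x + c) - σ * bracketPow α x) := by
  rcases (norm_nonneg v).eq_or_lt with hv0 | hv0
  · have : v = 0 := by rw [← norm_le_zero_iff, hv0]
    simp [this]
  have hσ2 : σ * σ = 1 := by rcases hσ with rfl | rfl <;> norm_num
  have hση : ‖σ‖ = 1 := by rcases hσ with rfl | rfl <;> norm_num
  have hη : 0 ≤ 1 - (α - 1) ^ 2 / 32 ∧ 1 / 2 ≤ 1 - (α - 1) ^ 2 / 32 := by
    constructor <;> nlinarith
  set η := (α - 1) ^ 2 / 32
  have hf : ∀ t : ℝ, HasDerivAt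
      (fun t : ℝ => bracketPow α (x + c + t • v) - σ * bracketPow α (x + t • v))
      (α * inner ℝ v (bracketGrad α (x + c + t • v) - bracketGrad α (σ • (x + t • v)))) t := by
    intro t
    refine ((hasDerivAt_bracketPow_line α (x + c) v t).sub
      ((hasDerivAt_bracketPow_line α x v t).const_mul σ)).congr_deriv ?_
    have : bracketGrad α (σ • (x + t • v)) = σ • bracketGrad α (x + t • v) := by
      rw [bracketGrad, bracketGrad, radialWeight, radialWeight, norm_smul, hση, one_mul, smul_comm]
    rw [this, inner_sub_right, inner_smul_right]; ring
  have main := Convex.mul_sub_le_image_sub_of_le_deriv (convex_Icc 0 s)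
    (f := fun t : ℝ => bracketPow α (x + c + t • v) - σ * bracketPow α (x + t • v))
    (fun t _ => (hf t).continuousAt.continuousWithinAt)
    (fun t _ => (hf t).differentiableAt.differentiableWithinAt)
    (C := (α - 1) / 2 * (r / (4 * B + r)) * ‖v‖) ?_ 0 ⟨le_rfl, hs⟩ s ⟨hs, le_rfl⟩ hs
  · simp only [zero_smul, add_zero, sub_zero] at main
    rw [add_right_comm x (s • v) c]
    linarith
  intro t ht
  rw [interior_Icc] at ht
  rw [(hf t).deriv]
  have hs0 : 0 < s := ht.1.trans ht.2
  set τ := t / s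
  have hτ0 : 0 ≤ τ := div_nonneg ht.1.le hs
  have hτ1 : 0 ≤ 1 - τ := by rw [sub_nonneg, div_le_one hs0]; exact ht.2.le
  have hτs : τ * s = t := div_mul_cancel₀ t hs0.ne'
  have hX : ‖x + t • v‖ ≤ B := by
    have : x + t • v = (1 - τ) • x + τ • (x + s • v) := by
      rw [smul_add, smul_smul, hτs, sub_smul, one_smul]; abel
    rw [this]
    refine (norm_add_le _ _).trans ?_
    rw [norm_smul, norm_smul, Real.norm_of_nonneg hτ0, Real.norm_of_nonneg hτ1]
    nlinarith
  set e₀ := x + c - σ • x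
  set e₁ := x + s • v + c - σ • (x + s • v)
  set e := x + c + t • v - σ • (x + t • v) with hedef
  have hecomb : e = (1 - τ) • e₀ + τ • e₁ := by
    simp only [hedef, e₀, e₁, ← hτs]
    module
  have henorm : ‖e‖ ≤ (1 - τ) * ‖e₀‖ + τ * ‖e₁‖ := by
    rw [hecomb]
    refine (norm_add_le _ _).trans ?_
    rw [norm_smul, norm_smul, Real.norm_of_nonneg hτ0, Real.norm_of_nonneg hτ1]
  have hin : (1 - η) * (‖v‖ * ((1 - τ) * ‖e₀‖ + τ * ‖e₁‖)) ≤ inner ℝ v e := by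
    rw [hecomb, inner_add_right, inner_smul_right, inner_smul_right]
    have h0 := mul_le_mul_of_nonneg_left hc hτ1
    have h1 := mul_le_mul_of_nonneg_left hc' hτ0
    nlinarith
  have hcone : InCone η v e :=
    le_trans (mul_le_mul_of_nonneg_left (mul_le_mul_of_nonneg_left henorm hv0.le) hη.1) hin
  have her : r / 2 ≤ ‖e‖ := by
    have h1 : (1 - η) * (‖v‖ * r) ≤ inner ℝ v e := by
      refine le_trans (mul_le_mul_of_nonneg_left (mul_le_mul_of_nonneg_left ?_ hv0.le) hη.1) hin
      nlinarith
    have h2 := h1.trans (real_inner_le_norm v e)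
    have h3 : (1 - η) * r ≤ ‖e‖ := le_of_mul_le_mul_left (by linarith) hv0
    nlinarith
  have hσX : ‖σ • (x + t • v)‖ ≤ B := by rwa [norm_smul, hση, one_mul]
  have hY : ‖x + c + t • v‖ ≤ B + ‖e‖ := by
    have : x + c + t • v = σ • (x + t • v) + e := by rw [hedef]; abel
    rw [this]
    exact (norm_add_le _ _).trans (by linarith)
  have hgrad := inner_bracketGrad_sub_ge hα₁ hα₂ (L := B + ‖e‖)
    (hσX.trans (by linarith [norm_nonneg e])) hY hcone
  rw [← hedef] at hgrad
  have hfrac : r / (4 * B + r) ≤ ‖e‖ / (1 + (B + ‖e‖)) := by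
    rw [div_le_div_iff₀ (by linarith) (by linarith)]
    nlinarith
  have hpos : 0 ≤ (α - 1) / 2 * ‖v‖ := mul_nonneg (by linarith) hv0.le
  have h5 := mul_le_mul_of_nonneg_left hfrac hpos
  have h6 : 0 ≤ (α - 1) / 2 * ‖v‖ * (r / (4 * B + r)) := mul_nonneg hpos (by positivity)
  nlinarith

end Analysis

section Lattice

/-- The lattice `ℤ³` inside Euclidean space. -/
def toE (n : Fin 3 → ℤ) : EuclideanSpace ℝ (Fin 3) := WithLp.toLp 2 (fun i => (n i : ℝ))

@[simp] lemma toE_apply (n : Fin 3 → ℤ) (i : Fin 3) : toE n i = n i := rfl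

lemma toE_add (a b : Fin 3 → ℤ) : toE (a + b) = toE a + toE b := by
  ext i; simp

lemma toE_neg (a : Fin 3 → ℤ) : toE (-a) = -toE a := by
  ext i; simp

lemma norm_toE (n : Fin 3 → ℤ) : ‖toE n‖ = znorm n := by
  simp [EuclideanSpace.norm_eq, znorm]

lemma abs_apply_le_norm_toE (n : Fin 3 → ℤ) (i : Fin 3) : |(n i : ℝ)| ≤ ‖toE n‖ := by
  simpa using PiLp.norm_apply_le (toE n) i

lemma one_le_norm_toE {n : Fin 3 → ℤ} (hn : n ≠ 0) : 1 ≤ ‖toE n‖ := by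
  obtain ⟨i, hi⟩ := Function.ne_iff.1 hn
  refine le_trans ?_ (abs_apply_le_norm_toE n i)
  exact_mod_cast Int.one_le_abs hi

lemma abs_jbb_sub_bracketPow_le {α : ℝ} (hα : 0 ≤ α) (n : Fin 3 → ℤ) :
    |jbb α n - bracketPow α (toE n)| ≤ 1 := by
  set z := bracketPow α (toE n) with hz
  have hsum : ∑ i, ((n i : ℝ)) ^ 2 = ‖toE n‖ ^ 2 := by
    rw [norm_toE, znorm, Real.sq_sqrt (by positivity)]
  have hz1 : 1 ≤ z := Real.one_le_rpow (by nlinarith [norm_nonneg (toE n)]) (by linarith)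
  have hjb : jb n ^ (2 * α) = z ^ 2 := by
    rw [jb, hsum, hz, bracketPow, Real.sqrt_eq_rpow, ← Real.rpow_mul (by positivity),
      ← Real.rpow_mul_natCast (by positivity)]
    congr 1; push_cast; ring
  rw [jbb, hjb, abs_le]
  constructor
  · have : z - 1 ≤ Real.sqrt (z ^ 2 - 1 / 4) := Real.le_sqrt_of_sq_le (by nlinarith)
    linarith
  · have : Real.sqrt (z ^ 2 - 1 / 4) ≤ z := by
      rw [Real.sqrt_le_left (by linarith)]; linarith
    linarith

/-- The integers in `[-K, K]`. -/
def intBox (K : ℝ) : Finset ℤ := Finset.Icc (-⌊K⌋) ⌊K⌋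

/-- The lattice points with all coordinates in `[-K, K]`. -/
def latBox (K : ℝ) : Finset (Fin 3 → ℤ) := Fintype.piFinset fun _ => intBox K

lemma mem_intBox {K : ℝ} {x : ℤ} : x ∈ intBox K ↔ |(x : ℝ)| ≤ K := by
  rw [intBox, Finset.mem_Icc, neg_le, Int.le_floor, Int.le_floor, abs_le, neg_le]
  push_cast
  rfl

lemma mem_latBox {K : ℝ} {n : Fin 3 → ℤ} : n ∈ latBox K ↔ ∀ i, |(n i : ℝ)| ≤ K := by
  simp [latBox, mem_intBox]

lemma mem_latBox_of_norm_le {K : ℝ} {n : Fin 3 → ℤ} (h : ‖toE n‖ ≤ K) : n ∈ latBox K :=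
  mem_latBox.2 fun i => (abs_apply_le_norm_toE n i).trans h

lemma card_intBox_le {K : ℝ} (hK : 1 ≤ K) : ((intBox K).card : ℝ) ≤ 3 * K := by
  have h0 : (1 : ℤ) ≤ ⌊K⌋ := Int.le_floor.2 (by exact_mod_cast hK)
  have h1 : (((intBox K).card : ℤ) : ℝ) = ((⌊K⌋ + 1 - -⌊K⌋ : ℤ) : ℝ) := by
    rw [intBox, Int.card_Icc, Int.toNat_of_nonneg (by omega)]
  have h2 := Int.floor_le K
  push_cast at h1
  rw [h1]; linarith

lemma card_latBox_le {K : ℝ} (hK : 1 ≤ K) : ((latBox K).card : ℝ) ≤ 27 * K ^ 3 := by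
  rw [latBox, Fintype.card_piFinset]
  push_cast
  rw [Finset.prod_const, Finset.card_univ, Fintype.card_fin]
  calc ((intBox K).card : ℝ) ^ 3 ≤ (3 * K) ^ 3 := by
        gcongr; exact card_intBox_le hK
    _ = _ := by ring

/-- An antiderivative (up to constants) of `|u|^{-1/2}`. -/
def signedSqrt (u : ℝ) : ℝ := if 0 ≤ u then Real.sqrt u else -Real.sqrt (-u)

lemma inv_sqrt_le_signedSqrt_sub (u : ℝ) :
    (Real.sqrt (1 + |u|))⁻¹ ≤ 2 * (signedSqrt (u + 1) - signedSqrt u) := by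
  have telescope : ∀ p : ℝ, 0 ≤ p →
      (Real.sqrt (1 + p))⁻¹ ≤ 2 * (Real.sqrt (p + 1) - Real.sqrt p) := by
    intro p hp
    have h1 : 0 < Real.sqrt (1 + p) := Real.sqrt_pos.2 (by linarith)
    have h2 : Real.sqrt p ≤ Real.sqrt (1 + p) := Real.sqrt_le_sqrt (by linarith)
    have h3 := Real.sq_sqrt hp
    have h4 := Real.sq_sqrt (show 0 ≤ 1 + p by linarith)
    rw [add_comm p 1, inv_le_iff_one_le_mul₀ h1]
    nlinarith [Real.sqrt_nonneg p]
  rcases le_or_gt 0 u with hu | hu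
  · rw [signedSqrt, signedSqrt, if_pos hu, if_pos (by linarith), abs_of_nonneg hu]
    exact telescope u hu
  rw [abs_of_neg hu]
  rcases le_or_gt (-1) u with hu' | hu'
  · rw [signedSqrt, signedSqrt, if_neg hu.not_ge, if_pos (by linarith)]
    have h1 : u + 1 ≤ Real.sqrt (u + 1) := Real.le_sqrt_of_sq_le (by nlinarith)
    have h2 : -u ≤ Real.sqrt (-u) := Real.le_sqrt_of_sq_le (by nlinarith)
    have h3 : (Real.sqrt (1 + -u))⁻¹ ≤ 1 := inv_le_one_of_one_le₀ (Real.one_le_sqrt.2 (by linarith))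
    linarith
  · rw [signedSqrt, signedSqrt, if_neg hu.not_ge, if_neg (by linarith)]
    have h1 := telescope (-u - 1) (by linarith)
    rw [show -u - 1 + 1 = -u by ring, show -u - 1 = -(u + 1) by ring] at h1
    have h2 : (Real.sqrt (1 + -u))⁻¹ ≤ (Real.sqrt (1 + -(u + 1)))⁻¹ :=
      inv_anti₀ (Real.sqrt_pos.2 (by linarith)) (Real.sqrt_le_sqrt (by linarith))
    linarith

lemma signedSqrt_sub_le {x y : ℝ} (h : x ≤ y) :
    signedSqrt y - signedSqrt x ≤ 2 * Real.sqrt (y - x) := by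
  have sub_le : ∀ p q : ℝ, 0 ≤ p → p ≤ q → Real.sqrt q - Real.sqrt p ≤ Real.sqrt (q - p) := by
    intro p q hp hpq
    rw [sub_le_iff_le_add, Real.sqrt_le_left (by positivity)]
    nlinarith [Real.sq_sqrt hp, Real.sq_sqrt (sub_nonneg.2 hpq),
      mul_nonneg (Real.sqrt_nonneg (q - p)) (Real.sqrt_nonneg p)]
  have hnn := Real.sqrt_nonneg (y - x)
  unfold signedSqrt
  split_ifs with hy hx hx
  · linarith [sub_le x y hx h]
  · have h1 : Real.sqrt y ≤ Real.sqrt (y - x) := Real.sqrt_le_sqrt (by linarith)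
    have h2 : Real.sqrt (-x) ≤ Real.sqrt (y - x) := Real.sqrt_le_sqrt (by linarith)
    linarith
  · linarith
  · have := sub_le (-y) (-x) (by linarith) (by linarith)
    rw [show -x - -y = y - x by ring] at this
    linarith

lemma sum_Ico_inv_sqrt_le (x₀ : ℝ) (a : ℤ) (n : ℕ) :
    ∑ t ∈ Finset.Ico a (a + n), (Real.sqrt (1 + |(t : ℝ) + x₀|))⁻¹ ≤
      2 * (signedSqrt (a + n + x₀) - signedSqrt (a + x₀)) := by
  induction n with
  | zero => simp
  | succ n ih =>
    have : Finset.Ico a (a + ((n + 1 : ℕ) : ℤ)) = insert (a + (n : ℤ)) (Finset.Ico a (a + n)) := by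
      ext t; simp only [Finset.mem_Ico, Finset.mem_insert]; push_cast; omega
    rw [this, Finset.sum_insert (by simp)]
    have h := inv_sqrt_le_signedSqrt_sub (a + n + x₀)
    rw [show (a : ℝ) + n + x₀ + 1 = a + (n + 1 : ℕ) + x₀ by push_cast; ring] at h
    push_cast at h ih ⊢
    linarith

lemma sum_intBox_inv_sqrt_le (x₀ : ℝ) {K : ℝ} (hK : 1 ≤ K) :
    ∑ t ∈ intBox K, (Real.sqrt (1 + |(t : ℝ) + x₀|))⁻¹ ≤ 8 * Real.sqrt K := by
  have h0 : (1 : ℤ) ≤ ⌊K⌋ := Int.le_floor.2 (by exact_mod_cast hK)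
  obtain ⟨n, hn⟩ := Int.eq_ofNat_of_zero_le (show 0 ≤ 2 * ⌊K⌋ + 1 by omega)
  have hbox : intBox K = Finset.Ico (-⌊K⌋) (-⌊K⌋ + n) := by
    ext t; simp only [intBox, Finset.mem_Icc, Finset.mem_Ico]; omega
  rw [hbox]
  refine (sum_Ico_inv_sqrt_le x₀ _ n).trans ?_
  have hnn : (0 : ℝ) ≤ n := Nat.cast_nonneg n
  have h1 := signedSqrt_sub_le (show ((-⌊K⌋ : ℤ) : ℝ) + x₀ ≤ ((-⌊K⌋ : ℤ) : ℝ) + n + x₀ by linarith)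
  have h2 : (n : ℝ) ≤ 4 * K := by
    have : (n : ℝ) = 2 * (⌊K⌋ : ℝ) + 1 := by exact_mod_cast hn.symm
    linarith [Int.floor_le K]
  have h3 : Real.sqrt (((-⌊K⌋ : ℤ) : ℝ) + n + x₀ - (((-⌊K⌋ : ℤ) : ℝ) + x₀)) ≤ 2 * Real.sqrt K := by
    rw [show (2 : ℝ) = Real.sqrt (2 ^ 2) by rw [Real.sqrt_sq (by norm_num)],
      ← Real.sqrt_mul (by norm_num)]
    apply Real.sqrt_le_sqrt
    linarith
  linarith

lemma sum_intBox_prod_inv_sqrt_le (x₀ y₀ : ℝ) {K : ℝ} (hK : 1 ≤ K) :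
    ∑ w ∈ intBox K ×ˢ intBox K, (Real.sqrt (1 + |(w.1 : ℝ) + x₀|))⁻¹ *
      (Real.sqrt (1 + |(w.2 : ℝ) + y₀|))⁻¹ ≤ 64 * K := by
  rw [Finset.sum_product]
  simp only
  rw [← Finset.sum_mul_sum]
  calc _ ≤ (8 * Real.sqrt K) * (8 * Real.sqrt K) :=
        mul_le_mul (sum_intBox_inv_sqrt_le x₀ hK) (sum_intBox_inv_sqrt_le y₀ hK)
          (Finset.sum_nonneg fun _ _ => by positivity) (by positivity)
    _ = 64 * (Real.sqrt K * Real.sqrt K) := by ring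
    _ = _ := by rw [Real.mul_self_sqrt (by linarith)]

lemma card_le_of_separated {ι : Type*} (T : Finset ι) (ℓ : ι → ℤ) (ψ : ι → ℝ) {ζ K μ : ℝ}
    (hμ : 0 < μ) (hK : 0 ≤ K) (hψ : ∀ b ∈ T, |ψ b - ζ| ≤ K) (hinj : Set.InjOn ℓ T)
    (hsep : ∀ b ∈ T, ∀ b' ∈ T, μ * |(ℓ b' : ℝ) - ℓ b| ≤ |ψ b' - ψ b|) :
    (T.card : ℝ) ≤ 1 + 2 * K / μ := by
  classical
  rcases T.eq_empty_or_nonempty with rfl | hT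
  · simp only [Finset.card_empty, Nat.cast_zero]; positivity
  obtain ⟨b₀, hb₀, hmin⟩ := T.exists_min_image ℓ hT
  obtain ⟨b₁, hb₁, hmax⟩ := T.exists_max_image ℓ hT
  have hsub : T.image ℓ ⊆ Finset.Icc (ℓ b₀) (ℓ b₁) := by
    intro z hz
    obtain ⟨b, hb, rfl⟩ := Finset.mem_image.1 hz
    exact Finset.mem_Icc.2 ⟨hmin b hb, hmax b hb⟩
  have hcard : (T.card : ℤ) ≤ ℓ b₁ + 1 - ℓ b₀ := by
    have := Finset.card_le_card hsub
    rw [Finset.card_image_of_injOn hinj, Int.card_Icc] at this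
    have := hmin b₁ hb₁
    omega
  have hcard' : (T.card : ℝ) ≤ ℓ b₁ + 1 - ℓ b₀ := by exact_mod_cast hcard
  have h1 : μ * ((ℓ b₁ : ℝ) - ℓ b₀) ≤ 2 * K := by
    have h2 := hsep b₀ hb₀ b₁ hb₁
    have h3 := abs_le.1 (hψ b₀ hb₀)
    have h4 := abs_le.1 (hψ b₁ hb₁)
    have h5 : |ψ b₁ - ψ b₀| ≤ 2 * K := abs_le.2 ⟨by linarith, by linarith⟩
    exact (mul_le_mul_of_nonneg_left (le_abs_self _) hμ.le).trans (h2.trans h5)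
  have h6 : (ℓ b₁ : ℝ) - ℓ b₀ ≤ 2 * K / μ := by rw [le_div_iff₀ hμ]; linarith
  linarith

/-- Two integer coordinates that label the lines of direction `v` (if `v i ≠ 0`). -/
def lineProj (v : Fin 3 → ℤ) (i : Fin 3) (b : Fin 3 → ℤ) : ℤ × ℤ :=
  (v i * b (i + 1) - v (i + 1) * b i, v i * b (i + 2) - v (i + 2) * b i)

lemma toE_eq_of_lineProj_eq {v b b' : Fin 3 → ℤ} {i : Fin 3} (hv : v i ≠ 0)
    (h : lineProj v i b = lineProj v i b') :
    toE b' = toE b + (((b' i : ℝ) - b i) / v i) • toE v := by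
  have hv' : (v i : ℝ) ≠ 0 := by exact_mod_cast hv
  simp only [lineProj, Prod.mk.injEq] at h
  have h1 : (v i : ℝ) * b (i + 1) - v (i + 1) * b i = v i * b' (i + 1) - v (i + 1) * b' i := by
    exact_mod_cast h.1
  have h2 : (v i : ℝ) * b (i + 2) - v (i + 2) * b i = v i * b' (i + 2) - v (i + 2) * b' i := by
    exact_mod_cast h.2
  have cover : ∀ i j : Fin 3, j = i ∨ j = i + 1 ∨ j = i + 2 := by decide
  ext j
  simp only [PiLp.add_apply, PiLp.smul_apply, toE_apply, smul_eq_mul]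
  rcases cover i j with rfl | rfl | rfl <;> field_simp <;> linarith

lemma abs_lineProj_le {v b : Fin 3 → ℤ} {i : Fin 3} {M R : ℝ} (hv : ∀ j, |(v j : ℝ)| ≤ M)
    (hb : ∀ j, |(b j : ℝ)| ≤ R) :
    |((lineProj v i b).1 : ℝ)| ≤ 2 * M * R ∧ |((lineProj v i b).2 : ℝ)| ≤ 2 * M * R := by
  have hM : 0 ≤ M := (abs_nonneg _).trans (hv 0)
  have prod : ∀ j k, |(v j : ℝ) * b k| ≤ M * R := fun j k => by
    rw [abs_mul]; exact mul_le_mul (hv j) (hb k) (abs_nonneg _) hM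
  simp only [lineProj]
  push_cast
  constructor
  · have := abs_sub ((v i : ℝ) * b (i + 1)) (v (i + 1) * b i)
    linarith [prod i (i + 1), prod (i + 1) i]
  · have := abs_sub ((v i : ℝ) * b (i + 2)) (v (i + 2) * b i)
    linarith [prod i (i + 2), prod (i + 2) i]

end Lattice

section Counting

/-- Every nonzero vector is close in direction to a bounded nonzero lattice vector. -/
lemma exists_lattice_inCone {η M : ℝ} (hη : 0 < η) (hη₁ : η ≤ 1) (hM : 2 / η ≤ M)
    {e : EuclideanSpace ℝ (Fin 3)} (he : e ≠ 0) :
    ∃ v ∈ (latBox (M + 1)).erase 0, InCone η (toE v) e := by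
  have hM2 : 2 ≤ M := le_trans (by rw [le_div_iff₀ hη]; linarith) hM
  have hηM : 2 ≤ M * η := (div_le_iff₀ hη).1 hM
  have he' : 0 < ‖e‖ := norm_pos_iff.2 he
  set u := (M / ‖e‖) • e with hu
  have hun : ‖u‖ = M := by
    rw [hu, norm_smul, Real.norm_of_nonneg (by positivity), div_mul_cancel₀ _ he'.ne']
  set v : Fin 3 → ℤ := fun i => round (u i) with hv
  have hdiff : ‖toE v - u‖ ≤ 1 := by
    have hb : ∀ i, ‖(toE v - u) i‖ ^ 2 ≤ 1 / 4 := fun i => by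
      have h1 := abs_sub_round (u i)
      rw [abs_sub_comm] at h1
      have h2 : (toE v - u) i = round (u i) - u i := rfl
      rw [h2, Real.norm_eq_abs]
      nlinarith [abs_nonneg ((round (u i) : ℝ) - u i)]
    rw [EuclideanSpace.norm_eq, Real.sqrt_le_left zero_le_one, Fin.sum_univ_three]
    linarith [hb 0, hb 1, hb 2]
  have hvn : ‖toE v‖ ≤ M + 1 := by
    have := norm_add_le u (toE v - u)
    rw [add_sub_cancel] at this
    linarith
  have hinner : (M - 1) * ‖e‖ ≤ inner ℝ (toE v) e := by
    have h1 : inner ℝ (toE v) e = inner ℝ u e + inner ℝ (toE v - u) e := by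
      rw [inner_sub_left]; ring
    have h2 : inner ℝ u e = M * ‖e‖ := by
      rw [hu, real_inner_smul_left, real_inner_self_eq_norm_sq]; field_simp
    have h3 := neg_le_of_abs_le (abs_real_inner_le_norm (toE v - u) e)
    nlinarith
  refine ⟨v, Finset.mem_erase.2 ⟨?_, mem_latBox_of_norm_le hvn⟩, ?_⟩
  · intro h0
    have : toE v = 0 := by rw [h0]; ext i; simp
    rw [this, inner_zero_left] at hinner
    nlinarith
  · refine le_trans ?_ hinner
    have h1 : (1 - η) * ‖toE v‖ ≤ M - 1 := by nlinarith
    nlinarith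

/-- The phase `⟨b + c⟩^α - σ ⟨b⟩^α` at lattice points. -/
def phase (α σ : ℝ) (c b : Fin 3 → ℤ) : ℝ :=
  bracketPow α (toE b + toE c) - σ * bracketPow α (toE b)

/-- The difference of the arguments at which the gradients enter the gradient of `phase`. -/
def offset (σ : ℝ) (c b : Fin 3 → ℤ) : EuclideanSpace ℝ (Fin 3) := toE b + toE c - σ • toE b

lemma phase_separated {α : ℝ} (hα₁ : 1 < α) (hα₂ : α ≤ 2) {σ : ℝ} (hσ : σ = 1 ∨ σ = -1)
    {c v b b' : Fin 3 → ℤ} {i : Fin 3} {B r : ℝ} (hvi : v i ≠ 0) (hB : 1 ≤ B) (hr : 0 < r)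
    (hline : lineProj v i b = lineProj v i b') (hb : ‖toE b‖ ≤ B) (hb' : ‖toE b'‖ ≤ B)
    (hc : InCone ((α - 1) ^ 2 / 32) (toE v) (offset σ c b))
    (hc' : InCone ((α - 1) ^ 2 / 32) (toE v) (offset σ c b'))
    (he : r ≤ ‖offset σ c b‖) (he' : r ≤ ‖offset σ c b'‖) :
    (α - 1) / 2 * (r / (4 * B + r)) * |(b' i : ℝ) - b i| ≤
      |phase α σ c b' - phase α σ c b| := by
  have hvi' : (v i : ℝ) ≠ 0 := by exact_mod_cast hvi
  have hline' := toE_eq_of_lineProj_eq hvi hline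
  wlog hs : 0 ≤ ((b' i : ℝ) - b i) / v i generalizing b b'
  · rw [abs_sub_comm, abs_sub_comm (phase _ _ _ _)]
    refine this hline.symm hb' hb hc' hc he' he (toE_eq_of_lineProj_eq hvi hline.symm) ?_
    rw [← neg_sub, neg_div]; linarith
  set s := ((b' i : ℝ) - b i) / v i with hsdef
  have key := bracketPow_phase_growth hα₁ hα₂ hσ (x := toE b) (c := toE c) (v := toE v) (s := s)
    hs hB hr hb (hline' ▸ hb') hc (by rw [← hline']; exact hc') he (by rw [← hline']; exact he')
  rw [← hline'] at key
  refine le_trans ?_ (key.trans (le_abs_self _))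
  have h1 : |(b' i : ℝ) - b i| = s * |(v i : ℝ)| := by
    rw [← abs_of_nonneg hs, ← abs_mul, hsdef, div_mul_cancel₀ _ hvi']
  rw [h1]
  have : 0 ≤ (α - 1) / 2 * (r / (4 * B + r)) :=
    mul_nonneg (by linarith) (div_nonneg hr.le (by linarith))
  gcongr
  exact abs_apply_le_norm_toE v i

lemma card_phase_cone_le {α : ℝ} (hα₁ : 1 < α) (hα₂ : α ≤ 2) {σ : ℝ} (hσ : σ = 1 ∨ σ = -1)
    {c v : Fin 3 → ℤ} {i : Fin 3} {B M ζ : ℝ} (hvi : v i ≠ 0) (hB : 1 ≤ B)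
    (hv : ∀ j, |(v j : ℝ)| ≤ M) (S : Finset (Fin 3 → ℤ)) (r : ℤ × ℤ → ℝ) (hr : ∀ w, 0 < r w)
    (hSB : ∀ b ∈ S, ‖toE b‖ ≤ B) (hSζ : ∀ b ∈ S, |phase α σ c b - ζ| ≤ 4)
    (hSc : ∀ b ∈ S, InCone ((α - 1) ^ 2 / 32) (toE v) (offset σ c b))
    (hSr : ∀ b ∈ S, r (lineProj v i b) ≤ ‖offset σ c b‖) :
    (S.card : ℝ) ≤ ∑ w ∈ intBox (2 * M * B) ×ˢ intBox (2 * M * B),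
      (1 + 16 / (α - 1) * (1 + 4 * B * (r w)⁻¹)) := by
  classical
  have hmaps : ∀ b ∈ S, lineProj v i b ∈ intBox (2 * M * B) ×ˢ intBox (2 * M * B) := by
    intro b hb
    rw [Finset.mem_product, mem_intBox, mem_intBox]
    exact abs_lineProj_le hv fun j => (abs_apply_le_norm_toE b j).trans (hSB b hb)
  rw [Finset.card_eq_sum_card_fiberwise hmaps]
  push_cast
  refine Finset.sum_le_sum fun w _ => ?_
  have hα0 : 0 < α - 1 := by linarith
  have hrw := hr w
  have hμ : 0 < (α - 1) / 2 * (r w / (4 * B + r w)) := by positivity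
  refine (card_le_of_separated _ (fun b => b i) (phase α σ c) (ζ := ζ) (K := 4) hμ (by norm_num)
    ?_ ?_ ?_).trans (le_of_eq ?_)
  · exact fun b hb => hSζ b (Finset.mem_filter.1 hb).1
  · intro b hb b' hb' hbb
    obtain ⟨_, hw⟩ := Finset.mem_filter.1 hb
    obtain ⟨_, hw'⟩ := Finset.mem_filter.1 hb'
    have h := toE_eq_of_lineProj_eq hvi (hw.trans hw'.symm)
    simp only at hbb
    rw [hbb, sub_self, zero_div, zero_smul, add_zero] at h
    funext j
    have := congrArg (fun x : EuclideanSpace ℝ (Fin 3) => x j) h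
    simp only [toE_apply] at this
    exact_mod_cast this.symm
  · intro b hb b' hb'
    obtain ⟨hbS, hw⟩ := Finset.mem_filter.1 hb
    obtain ⟨hbS', hw'⟩ := Finset.mem_filter.1 hb'
    exact phase_separated hα₁ hα₂ hσ hvi hB hrw (hw.trans hw'.symm) (hSB b hbS) (hSB b' hbS')
      (hSc b hbS) (hSc b' hbS') (hw ▸ hSr b hbS) (hw' ▸ hSr b' hbS')
  · field_simp
    ring

/-- Points are distributed over finitely many cones, and counted line by line in each of them. -/
lemma exists_card_phase_le {α : ℝ} (hα₁ : 1 < α) (hα₂ : α ≤ 2) :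
    ∃ M : ℝ, 1 ≤ M ∧ ∀ σ : ℝ, (σ = 1 ∨ σ = -1) → ∀ (c : Fin 3 → ℤ) (B ζ X : ℝ), 1 ≤ B →
      ∀ S : Finset (Fin 3 → ℤ), (∀ b ∈ S, offset σ c b ≠ 0) → (∀ b ∈ S, ‖toE b‖ ≤ B) →
      (∀ b ∈ S, |phase α σ c b - ζ| ≤ 4) →
      (∀ v : Fin 3 → ℤ, (∀ j, |(v j : ℝ)| ≤ M) → ∀ i, ∃ r : ℤ × ℤ → ℝ, (∀ w, 0 < r w) ∧
        (∀ b ∈ S, r (lineProj v i b) ≤ ‖offset σ c b‖) ∧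
        ∑ w ∈ intBox (2 * M * B) ×ˢ intBox (2 * M * B), (r w)⁻¹ ≤ X) →
      (S.card : ℝ) ≤ 27 * M ^ 3 * ((1 + 16 / (α - 1)) * (36 * M ^ 2 * B ^ 2) +
        64 / (α - 1) * (B * X)) := by
  classical
  have hα0 : 0 < α - 1 := by linarith
  set η := (α - 1) ^ 2 / 32 with hη
  have hη0 : 0 < η := by positivity
  have hη1 : η ≤ 1 := by rw [hη]; nlinarith
  refine ⟨2 / η + 1, by linarith [div_pos two_pos hη0], ?_⟩
  intro σ hσ c B ζ X hB S hS0 hSB hSζ hr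
  set M := 2 / η + 1 with hM
  have hM1 : 1 ≤ M := by linarith [div_pos two_pos hη0]
  have hMB : 1 ≤ 2 * M * B := by nlinarith
  have hX : 0 ≤ X := by
    obtain ⟨r, hr0, -, hrX⟩ := hr 0 (by simp; linarith) 0
    exact (Finset.sum_nonneg fun w _ => (inv_pos.2 (hr0 w)).le).trans hrX
  set V := (latBox M).erase 0 with hV
  set Sv := fun v : Fin 3 → ℤ => S.filter fun b => InCone η (toE v) (offset σ c b)
  have hcover : S ⊆ V.biUnion Sv := by
    intro b hb
    obtain ⟨v, hvV, hvc⟩ := exists_lattice_inCone hη0 hη1 le_rfl (hS0 b hb)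
    exact Finset.mem_biUnion.2 ⟨v, hvV, Finset.mem_filter.2 ⟨hb, hvc⟩⟩
  set Y := (1 + 16 / (α - 1)) * (36 * M ^ 2 * B ^ 2) + 64 / (α - 1) * (B * X) with hY
  have hYnn : 0 ≤ Y := by positivity
  have hone : ∀ v ∈ V, ((Sv v).card : ℝ) ≤ Y := by
    intro v hvV
    obtain ⟨hv0, hvb⟩ := Finset.mem_erase.1 hvV
    have hvM := mem_latBox.1 hvb
    obtain ⟨i, hi⟩ := Function.ne_iff.1 hv0
    obtain ⟨r, hr0, hrS, hrX⟩ := hr v hvM i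
    have hsub : ∀ b ∈ Sv v, b ∈ S := fun b hb => (Finset.mem_filter.1 hb).1
    refine (card_phase_cone_le hα₁ hα₂ hσ hi hB hvM (Sv v) r hr0 (fun b hb => hSB b (hsub b hb))
      (fun b hb => hSζ b (hsub b hb)) (fun b hb => (Finset.mem_filter.1 hb).2)
      (fun b hb => hrS b (hsub b hb))).trans ?_
    have hcard : ((intBox (2 * M * B) ×ˢ intBox (2 * M * B)).card : ℝ) ≤ 36 * M ^ 2 * B ^ 2 := by
      rw [Finset.card_product]
      push_cast
      have := card_intBox_le hMB
      calc _ ≤ (3 * (2 * M * B)) * (3 * (2 * M * B)) := by gcongr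
        _ = _ := by ring
    have hsplit : ∀ w, 1 + 16 / (α - 1) * (1 + 4 * B * (r w)⁻¹) =
        (1 + 16 / (α - 1)) + 64 / (α - 1) * B * (r w)⁻¹ := fun w => by ring
    simp only [hsplit]
    rw [Finset.sum_add_distrib, Finset.sum_const, nsmul_eq_mul, ← Finset.mul_sum, hY, mul_comm,
      ← mul_assoc (64 / (α - 1))]
    gcongr
  have hVcard : (V.card : ℝ) ≤ 27 * M ^ 3 :=
    le_trans (by exact_mod_cast Finset.card_le_card (Finset.erase_subset _ _)) (card_latBox_le hM1)
  calc (S.card : ℝ) ≤ ((V.biUnion Sv).card : ℝ) := by exact_mod_cast Finset.card_le_card hcover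
    _ ≤ ∑ v ∈ V, ((Sv v).card : ℝ) := by exact_mod_cast Finset.card_biUnion_le
    _ ≤ ∑ _v ∈ V, Y := Finset.sum_le_sum hone
    _ = V.card * Y := by rw [Finset.sum_const, nsmul_eq_mul]
    _ ≤ _ := by gcongr

/-- Counting for phases with opposite signs. -/
lemma exists_card_difference_phase_le {α : ℝ} (hα₁ : 1 < α) (hα₂ : α ≤ 2) :
    ∃ C : ℝ, 0 < C ∧ ∀ (c : Fin 3 → ℤ) (B ζ : ℝ), 1 ≤ B → ∀ S : Finset (Fin 3 → ℤ),
      (∀ b ∈ S, ‖toE b‖ ≤ B) → (∀ b ∈ S, |phase α 1 c b - ζ| ≤ 4) →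
      (S.card : ℝ) ≤ C * (B ^ 2 + B ^ 3 * ((Real.sqrt (1 + |(c 0 : ℝ)|))⁻¹ *
        (Real.sqrt (1 + |(c 1 : ℝ)|))⁻¹)) := by
  obtain ⟨M, hM, hcount⟩ := exists_card_phase_le hα₁ hα₂
  have hα0 : 0 < α - 1 := by linarith
  set P := 27 * M ^ 3 * ((1 + 16 / (α - 1)) * (36 * M ^ 2)) with hP
  set Q := 27 * M ^ 3 * (64 / (α - 1) * (72 * M ^ 2)) with hQ
  have hP0 : 0 < P := by positivity
  have hQ0 : 0 < Q := by positivity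
  refine ⟨27 + P + Q, by positivity, ?_⟩
  intro c B ζ hB S hSB hSζ
  set A := (Real.sqrt (1 + |(c 0 : ℝ)|))⁻¹ * (Real.sqrt (1 + |(c 1 : ℝ)|))⁻¹ with hA
  have hA0 : 0 < A := by positivity
  have hB0 : 0 < B := by linarith
  by_cases hc : c = 0
  · have hA1 : A = 1 := by simp [hA, hc]
    have h1 : (S.card : ℝ) ≤ 27 * B ^ 3 :=
      le_trans (by exact_mod_cast Finset.card_le_card fun b hb => mem_latBox_of_norm_le (hSB b hb))
        (card_latBox_le hB)
    rw [hA1]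
    have h2 : 0 ≤ (27 + P + Q) * B ^ 2 := by positivity
    have h3 : 0 ≤ (P + Q) * B ^ 3 := by positivity
    linarith
  have hc1 := one_le_norm_toE hc
  have hinv : ‖toE c‖⁻¹ ≤ 2 * A := by
    have h0 := abs_apply_le_norm_toE c 0
    have h1 := abs_apply_le_norm_toE c 1
    have hs : Real.sqrt (1 + |(c 0 : ℝ)|) * Real.sqrt (1 + |(c 1 : ℝ)|) ≤ 2 * ‖toE c‖ := by
      rw [← Real.sqrt_mul (by positivity), Real.sqrt_le_left (by positivity)]
      calc _ ≤ (2 * ‖toE c‖) * (2 * ‖toE c‖) := by gcongr <;> linarith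
        _ = _ := by ring
    rw [hA, ← mul_inv, ← div_eq_mul_inv, inv_le_comm₀ (by positivity) (by positivity), inv_div]
    linarith
  have hoff : ∀ b, offset 1 c b = toE c := fun b => by simp [offset]
  have main := hcount 1 (Or.inl rfl) c B ζ (72 * M ^ 2 * B ^ 2 * A) hB S
    (fun b _ => by rw [hoff, ← norm_pos_iff]; linarith) hSB hSζ ?_
  · refine main.trans ?_
    have e1 : 27 * M ^ 3 * ((1 + 16 / (α - 1)) * (36 * M ^ 2 * B ^ 2) +
        64 / (α - 1) * (B * (72 * M ^ 2 * B ^ 2 * A))) = P * B ^ 2 + Q * (B ^ 3 * A) := by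
      rw [hP, hQ]; ring
    rw [e1]
    have h2 : 0 ≤ (27 + Q) * B ^ 2 := by positivity
    have h3 : 0 ≤ (27 + P) * (B ^ 3 * A) := by positivity
    linarith
  · intro v _ i
    refine ⟨fun _ => ‖toE c‖, fun _ => by linarith, fun b _ => by rw [hoff], ?_⟩
    have hMB : 1 ≤ 2 * M * B := by nlinarith
    have := card_intBox_le hMB
    rw [Finset.sum_const, nsmul_eq_mul, Finset.card_product]
    push_cast
    calc _ ≤ (3 * (2 * M * B)) * (3 * (2 * M * B)) * (2 * A) := by gcongr
      _ = _ := by ring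

/-- Counting for phases with equal signs. -/
lemma exists_card_sum_phase_le {α : ℝ} (hα₁ : 1 < α) (hα₂ : α ≤ 2) :
    ∃ C : ℝ, 0 < C ∧ ∀ (c : Fin 3 → ℤ) (B ζ : ℝ), 1 ≤ B → ∀ S : Finset (Fin 3 → ℤ),
      (∀ b ∈ S, ‖toE b‖ ≤ B) → (∀ b ∈ S, |phase α (-1) c b - ζ| ≤ 4) →
      (S.card : ℝ) ≤ C * B ^ 2 := by
  classical
  obtain ⟨M, hM, hcount⟩ := exists_card_phase_le hα₁ hα₂
  have hα0 : 0 < α - 1 := by linarith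
  set P := 27 * M ^ 3 * ((1 + 16 / (α - 1)) * (36 * M ^ 2) +
    64 / (α - 1) * ((1 + 2 * M) * (128 * M))) with hP
  have hP0 : 0 < P := by positivity
  refine ⟨1 + P, by positivity, ?_⟩
  intro c B ζ hB S hSB hSζ
  have hB0 : 0 < B := by linarith
  have hoff : ∀ b, offset (-1) c b = toE (b + b + c) := fun b => by
    rw [offset, toE_add, toE_add]; module
  have hzero : ∀ b, offset (-1) c b = 0 → b + b + c = 0 := fun b hb => by
    by_contra h
    have := one_le_norm_toE h
    rw [← hoff, hb, norm_zero] at this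
    linarith
  set S₀ := S.filter fun b => offset (-1) c b = 0
  set S₁ := S.filter fun b => ¬ offset (-1) c b = 0
  have hS₀ : S₀.card ≤ 1 := by
    refine Finset.card_le_one.2 fun b hb b' hb' => ?_
    have h := hzero b (Finset.mem_filter.1 hb).2
    have h' := hzero b' (Finset.mem_filter.1 hb').2
    funext j
    have h1 := congrFun h j
    have h2 := congrFun h' j
    simp only [Pi.add_apply, Pi.zero_apply] at h1 h2
    omega
  have hS₁ : (S₁.card : ℝ) ≤ P * B ^ 2 := by
    have hsub : ∀ b ∈ S₁, b ∈ S := fun b hb => (Finset.mem_filter.1 hb).1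
    have main := hcount (-1) (Or.inr rfl) c B ζ ((1 + 2 * M) * (128 * M) * B) hB S₁
      (fun b hb => (Finset.mem_filter.1 hb).2) (fun b hb => hSB b (hsub b hb))
      (fun b hb => hSζ b (hsub b hb)) ?_
    · refine main.trans (le_of_eq ?_)
      rw [hP]; ring
    intro v hv i
    set x₀ : ℝ := ((lineProj v i c).1 : ℝ) / 2 with hx₀
    set y₀ : ℝ := ((lineProj v i c).2 : ℝ) / 2 with hy₀
    refine ⟨fun w => (Real.sqrt (1 + |(w.1 : ℝ) + x₀|) * Real.sqrt (1 + |(w.2 : ℝ) + y₀|)) /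
      (1 + 2 * M), fun w => by positivity, ?_, ?_⟩
    · intro b hb
      have hne : b + b + c ≠ 0 := fun h => (Finset.mem_filter.1 hb).2 (by
        rw [hoff, h]; ext j; simp)
      have h1 := one_le_norm_toE hne
      obtain ⟨hp1, hp2⟩ := abs_lineProj_le (i := i) hv (abs_apply_le_norm_toE (b + b + c))
      rw [hoff]
      set R := ‖toE (b + b + c)‖
      have e1 : ((lineProj v i (b + b + c)).1 : ℝ) = 2 * ((lineProj v i b).1 + x₀) := by
        simp only [hx₀, lineProj, Pi.add_apply]; push_cast; ring
      have e2 : ((lineProj v i (b + b + c)).2 : ℝ) = 2 * ((lineProj v i b).2 + y₀) := by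
        simp only [hy₀, lineProj, Pi.add_apply]; push_cast; ring
      rw [e1, abs_mul, abs_two] at hp1
      rw [e2, abs_mul, abs_two] at hp2
      rw [div_le_iff₀ (by positivity), ← Real.sqrt_mul (by positivity),
        Real.sqrt_le_left (by positivity)]
      have hMR : 0 ≤ M * R := by positivity
      calc _ ≤ (R * (1 + 2 * M)) * (R * (1 + 2 * M)) := by gcongr <;> nlinarith
        _ = _ := by ring
    · have hMB : 1 ≤ 2 * M * B := by nlinarith
      have hsum := sum_intBox_prod_inv_sqrt_le x₀ y₀ hMB
      simp only [inv_div, div_eq_mul_inv (1 + 2 * M), mul_inv]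
      rw [← Finset.mul_sum]
      calc _ ≤ (1 + 2 * M) * (64 * (2 * M * B)) := by gcongr
        _ = _ := by ring
  have hsum : (S.card : ℝ) = S₀.card + S₁.card := by
    exact_mod_cast (Finset.card_filter_add_card_filter_not (s := S) _).symm
  have h0 : (S₀.card : ℝ) ≤ 1 := by exact_mod_cast hS₀
  have hB2 : 1 ≤ B ^ 2 := one_le_pow₀ hB
  linarith

end Counting

section Pairs

lemma sum_latBox_inv_sqrt_le (x₀ y₀ : ℝ) {K : ℝ} (hK : 1 ≤ K) :
    ∑ d ∈ latBox K, (Real.sqrt (1 + |(d 0 : ℝ) + x₀|))⁻¹ * (Real.sqrt (1 + |(d 1 : ℝ) + y₀|))⁻¹ ≤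
      192 * K ^ 2 := by
  have h := Finset.prod_univ_sum (fun _ : Fin 3 => intBox K)
    (![fun t : ℤ => (Real.sqrt (1 + |(t : ℝ) + x₀|))⁻¹,
      fun t : ℤ => (Real.sqrt (1 + |(t : ℝ) + y₀|))⁻¹, fun _ => 1] : Fin 3 → ℤ → ℝ)
  simp only [Fin.prod_univ_three, Matrix.cons_val_zero, Matrix.cons_val_one, Matrix.cons_val,
    mul_one, Finset.sum_const, nsmul_eq_mul] at h
  rw [latBox, ← h]
  calc _ ≤ (8 * Real.sqrt K) * (8 * Real.sqrt K) * (3 * K) :=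
        mul_le_mul (mul_le_mul (sum_intBox_inv_sqrt_le x₀ hK) (sum_intBox_inv_sqrt_le y₀ hK)
          (Finset.sum_nonneg fun _ _ => by positivity) (by positivity)) (card_intBox_le hK)
          (by positivity) (by positivity)
    _ = 192 * (Real.sqrt K * Real.sqrt K) * K := by ring
    _ = _ := by rw [Real.mul_self_sqrt (by linarith)]; ring

lemma card_le_sum_of_fibers {β γ δ : Type*} [DecidableEq β] [DecidableEq γ]
    (T : Finset δ) (f : δ → β) (g : δ → γ) (D : Finset β) (X : β → ℝ)
    (hmaps : ∀ p ∈ T, f p ∈ D) (hinj : ∀ p ∈ T, ∀ p' ∈ T, f p = f p' → g p = g p' → p = p')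
    (hX : ∀ d ∈ D, (((T.filter fun p => f p = d).image g).card : ℝ) ≤ X d) :
    (T.card : ℝ) ≤ ∑ d ∈ D, X d := by
  rw [Finset.card_eq_sum_card_fiberwise hmaps]
  push_cast
  refine Finset.sum_le_sum fun d hd => le_trans (le_of_eq ?_) (hX d hd)
  rw [Finset.card_image_of_injOn]
  intro p hp p' hp' h
  obtain ⟨h1, h2⟩ := Finset.mem_filter.1 hp
  obtain ⟨h1', h2'⟩ := Finset.mem_filter.1 hp'
  exact hinj p h1 p' h1' (h2.trans h2'.symm) h

lemma abs_sub_le_of_sign {s x k ζ K : ℝ} (hs : IsSign s) (h : |s * x + k - ζ| ≤ K) :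
    |x - s * (ζ - k)| ≤ K := by
  rw [abs_le] at h ⊢
  rcases hs with rfl | rfl <;> constructor <;> linarith [h.1, h.2]

lemma IsSign.abs_mul {s : ℝ} (hs : IsSign s) (x : ℝ) : |s * x| = |x| := by
  rcases hs with rfl | rfl <;> simp

lemma sum_difference_bound_le {C A B K x₀ y₀ : ℝ} (hC : 0 < C) (hB : 1 ≤ B) (hBA : B ≤ A)
    (hK : 1 ≤ K) (hKA : K ≤ 2 * A) :
    ∑ d ∈ latBox K, C * (B ^ 2 + B ^ 3 * ((Real.sqrt (1 + |(d 0 : ℝ) + x₀|))⁻¹ *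
      (Real.sqrt (1 + |(d 1 : ℝ) + y₀|))⁻¹)) ≤ 984 * C * (A ^ 3 * B ^ 2) := by
  have hB0 : 0 < B := by linarith
  have hA0 : 0 < A := by linarith
  rw [← Finset.mul_sum, Finset.sum_add_distrib, Finset.sum_const, nsmul_eq_mul, ← Finset.mul_sum]
  have h1 : ((latBox K).card : ℝ) ≤ 27 * (2 * A) ^ 3 := (card_latBox_le hK).trans (by gcongr)
  have h2 := (sum_latBox_inv_sqrt_le x₀ y₀ hK).trans
    (show 192 * K ^ 2 ≤ 192 * (2 * A) ^ 2 by gcongr)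
  calc _ ≤ C * (27 * (2 * A) ^ 3 * B ^ 2 + B ^ 3 * (192 * (2 * A) ^ 2)) := by gcongr
    _ = C * (216 * (A ^ 3 * B ^ 2) + 768 * (B * (A ^ 2 * B ^ 2))) := by ring
    _ ≤ C * (216 * (A ^ 3 * B ^ 2) + 768 * (A * (A ^ 2 * B ^ 2))) := by gcongr
    _ = _ := by ring

/-- Counting of two lattice points, one of size `A` and one of size `B ≤ A`. -/
lemma exists_card_pair_le {α : ℝ} (hα₁ : 1 < α) (hα₂ : α ≤ 2) :
    ∃ C : ℝ, 0 < C ∧ ∀ s₁ s₂ s₃ : ℝ, IsSign s₁ → IsSign s₂ → IsSign s₃ →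
      ∀ (c : Fin 3 → ℤ) (A B ζ : ℝ), 1 ≤ B → B ≤ A →
      ∀ T : Finset ((Fin 3 → ℤ) × (Fin 3 → ℤ)),
      (∀ p ∈ T, ‖toE p.1‖ ≤ A ∧ ‖toE p.2‖ ≤ B ∧
        |s₁ * jbb α p.1 + s₂ * jbb α p.2 + s₃ * jbb α (p.1 + p.2 + c) - ζ| ≤ 1) →
      (T.card : ℝ) ≤ C * (A ^ 3 * B ^ 2) := by
  classical
  obtain ⟨C₁, hC₁, hdiff⟩ := exists_card_difference_phase_le hα₁ hα₂
  obtain ⟨C₂, hC₂, hsum⟩ := exists_card_sum_phase_le hα₁ hα₂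
  refine ⟨984 * C₁ + 27 * C₂, by positivity, ?_⟩
  intro s₁ s₂ s₃ h₁ h₂ h₃ c A B ζ hB hBA T hT
  have hA : 1 ≤ A := hB.trans hBA
  have hT' : ∀ p ∈ T, |s₁ * bracketPow α (toE p.1) + s₂ * bracketPow α (toE p.2) +
      s₃ * bracketPow α (toE (p.1 + p.2 + c)) - ζ| ≤ 4 := by
    intro p hp
    have h0 := (hT p hp).2.2
    have err : ∀ s n, IsSign s → |s * (jbb α n - bracketPow α (toE n))| ≤ 1 := fun s n hs => by
      rw [hs.abs_mul]; exact abs_jbb_sub_bracketPow_le (by linarith) n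
    have e1 := err s₁ p.1 h₁
    have e2 := err s₂ p.2 h₂
    have e3 := err s₃ (p.1 + p.2 + c) h₃
    rw [abs_le] at *
    constructor <;> linarith [h0.1, h0.2, e1.1, e1.2, e2.1, e2.2, e3.1, e3.2]
  have hpos : 0 ≤ A ^ 3 * B ^ 2 := by positivity
  suffices hcases : (T.card : ℝ) ≤ 984 * C₁ * (A ^ 3 * B ^ 2) ∨
      (T.card : ℝ) ≤ 27 * C₂ * (A ^ 3 * B ^ 2) by
    have hp1 : 0 ≤ 984 * C₁ * (A ^ 3 * B ^ 2) := by positivity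
    have hp2 : 0 ≤ 27 * C₂ * (A ^ 3 * B ^ 2) := by positivity
    rcases hcases with h | h <;> linarith
  by_cases h23 : s₃ = -s₂
  · left
    refine (card_le_sum_of_fibers T Prod.fst Prod.snd (latBox A) _
      (fun p hp => mem_latBox_of_norm_le (hT p hp).1) (fun p _ p' _ => Prod.ext) ?_).trans
      (sum_difference_bound_le (x₀ := c 0) (y₀ := c 1) hC₁ hB hBA hA (by linarith))
    intro a _
    have := hdiff (a + c) B (s₃ * (ζ - s₁ * bracketPow α (toE a))) hB
      ((T.filter fun p => p.1 = a).image Prod.snd)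
    simp only [Finset.mem_image, Finset.mem_filter, Pi.add_apply, Int.cast_add] at this
    refine this ?_ ?_
    · rintro b ⟨p, ⟨hp, -⟩, rfl⟩
      exact (hT p hp).2.1
    · rintro b ⟨p, ⟨hp, rfl⟩, rfl⟩
      refine abs_sub_le_of_sign h₃ ?_
      have h := hT' p hp
      rw [phase, ← toE_add, show p.2 + (p.1 + c) = p.1 + p.2 + c by abel]
      rw [show s₂ = -s₃ by linarith] at h
      convert h using 2
      ring
  have h23' : s₃ = s₂ := by
    rcases h₂ with rfl | rfl <;> rcases h₃ with rfl | rfl <;> first | rfl | exact absurd (by norm_num) h23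
  by_cases h12 : s₂ = -s₁
  · left
    refine (card_le_sum_of_fibers T (fun p => p.1 + p.2) Prod.snd (latBox (2 * A)) _
      (fun p hp => mem_latBox_of_norm_le ?_) (fun p _ p' _ h h' => Prod.ext ?_ h') ?_).trans
      (sum_difference_bound_le (x₀ := 0) (y₀ := 0) hC₁ hB hBA (by linarith) le_rfl)
    · rw [toE_add]
      have := norm_add_le (toE p.1) (toE p.2)
      linarith [(hT p hp).1, (hT p hp).2.1]
    · simp only [h'] at h
      exact add_right_cancel h
    intro d _
    have := hdiff (-d) B (s₁ * (ζ - s₃ * bracketPow α (toE (d + c)))) hB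
      ((T.filter fun p => p.1 + p.2 = d).image Prod.snd)
    simp only [Finset.mem_image, Finset.mem_filter, Pi.neg_apply, Int.cast_neg, abs_neg] at this
    simp only [add_zero]
    refine this ?_ ?_
    · rintro b ⟨p, ⟨hp, -⟩, rfl⟩
      exact (hT p hp).2.1
    · rintro b ⟨p, ⟨hp, rfl⟩, rfl⟩
      refine abs_sub_le_of_sign h₁ ?_
      have h := hT' p hp
      rw [phase, ← toE_add, show p.2 + -(p.1 + p.2) = -p.1 by abel, toE_neg, bracketPow_neg]
      rw [h12] at h
      convert h using 2
      ring
  right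
  have h12' : s₂ = s₁ := by
    rcases h₁ with rfl | rfl <;> rcases h₂ with rfl | rfl <;> first | rfl | exact absurd (by norm_num) h12
  refine (card_le_sum_of_fibers T Prod.fst Prod.snd (latBox A) (fun _ => C₂ * B ^ 2)
      (fun p hp => mem_latBox_of_norm_le (hT p hp).1) (fun p _ p' _ => Prod.ext) ?_).trans ?_
  · intro a _
    refine hsum (a + c) B (s₃ * (ζ - s₁ * bracketPow α (toE a))) hB _ ?_ ?_ <;>
      simp only [Finset.mem_image, Finset.mem_filter]
    · rintro b ⟨p, ⟨hp, -⟩, rfl⟩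
      exact (hT p hp).2.1
    · rintro b ⟨p, ⟨hp, rfl⟩, rfl⟩
      refine abs_sub_le_of_sign h₃ ?_
      have h := hT' p hp
      rw [phase, ← toE_add, show p.2 + (p.1 + c) = p.1 + p.2 + c by abel]
      rw [← h23'] at h
      convert h using 2
      ring
  · rw [Finset.sum_const, nsmul_eq_mul]
    calc _ ≤ 27 * A ^ 3 * (C₂ * B ^ 2) := by gcongr; exact card_latBox_le hA
      _ = _ := by ring

end Pairs

section Tuples

lemma sum_eq_add_add_sum_erase_erase {ι M : Type*} [Fintype ι] [DecidableEq ι]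
    [AddCommMonoid M] {p q : ι} (hpq : p ≠ q) (F : ι → M) :
    ∑ i, F i = F p + (F q + ∑ i ∈ (Finset.univ.erase p).erase q, F i) := by
  rw [Finset.add_sum_erase _ _ (by simp [hpq.symm]), Finset.add_sum_erase _ _ (by simp)]

/-- Counting of tuples, with a gain from any two entries `p` and `q`. -/
lemma exists_card_tuple_le {α : ℝ} (hα₁ : 1 < α) (hα₂ : α ≤ 2) (k : ℕ) :
    ∃ C : ℝ, 0 < C ∧ ∀ (ε : Fin k → ℝ) (ε' : ℝ), (∀ i, IsSign (ε i)) → IsSign ε' →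
      ∀ (N : Fin k → ℝ) (ζ : ℝ) (p q : Fin k), (∀ i, 1 ≤ N i) → p ≠ q → N q ≤ N p →
      ∀ T : Finset (Fin k → Fin 3 → ℤ),
      (∀ n ∈ T, (∀ i, ‖toE (n i)‖ ≤ N i) ∧
        |∑ i, ε i * jbb α (n i) + ε' * jbb α (∑ i, n i) - ζ| ≤ 1) →
      (T.card : ℝ) ≤ C * (N q)⁻¹ * ∏ i, N i ^ 3 := by
  classical
  obtain ⟨C, hC, hpair⟩ := exists_card_pair_le hα₁ hα₂
  refine ⟨C * 27 ^ k, by positivity, ?_⟩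
  intro ε ε' hε hε' N ζ p q hN hpq hle T hT
  have hN0 : ∀ i, 0 < N i := fun i => by linarith [hN i]
  set I := (Finset.univ.erase p).erase q with hI
  set D : Finset (Fin k → Fin 3 → ℤ) :=
    Fintype.piFinset fun i => if i ∈ I then latBox (N i) else {0} with hD
  have hcount := card_le_sum_of_fibers T
    (fun n i => if i ∈ I then n i else 0) (fun n => (n p, n q)) D
    (fun _ => C * (N p ^ 3 * N q ^ 2)) ?_ ?_ ?_
  · refine hcount.trans ?_
    have hDcard : (D.card : ℝ) ≤ 27 ^ k * ∏ i ∈ I, N i ^ 3 := by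
      rw [hD, Fintype.card_piFinset]
      push_cast
      calc ∏ i, ((if i ∈ I then latBox (N i) else {0} : Finset (Fin 3 → ℤ)).card : ℝ)
          ≤ ∏ i, (27 * if i ∈ I then N i ^ 3 else 1) := by
            refine Finset.prod_le_prod (fun _ _ => by positivity) fun i _ => ?_
            split_ifs
            · exact card_latBox_le (hN i)
            · simp
        _ = _ := by
            rw [Finset.prod_mul_distrib, Finset.prod_const, Finset.card_univ, Fintype.card_fin,
              Finset.prod_ite_mem, Finset.univ_inter]
    have hprod : ∏ i, N i ^ 3 = N p ^ 3 * (N q ^ 3 * ∏ i ∈ I, N i ^ 3) := by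
      rw [hI, Finset.mul_prod_erase _ (fun i => N i ^ 3) (by simp [hpq.symm]),
        Finset.mul_prod_erase _ (fun i => N i ^ 3) (by simp)]
    have hp0 := hN0 p
    have hq0 := hN0 q
    rw [Finset.sum_const, nsmul_eq_mul, hprod]
    calc _ ≤ (27 ^ k * ∏ i ∈ I, N i ^ 3) * (C * (N p ^ 3 * N q ^ 2)) := by gcongr
      _ = _ := by field_simp
  · intro n hn
    rw [hD, Fintype.mem_piFinset]
    intro i
    split_ifs
    · exact mem_latBox_of_norm_le ((hT n hn).1 i)
    · simp
  · intro n _ n' _ h h'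
    simp only [Prod.mk.injEq] at h'
    funext i
    by_cases hi : i ∈ I
    · simpa [hi] using congrFun h i
    · have : i = q ∨ i = p := by
        by_contra hcon
        push Not at hcon
        exact hi (by simp [hI, hcon])
      rcases this with rfl | rfl
      · exact h'.2
      · exact h'.1
  · intro d _
    refine hpair (ε p) (ε q) ε' (hε p) (hε q) hε' (∑ i ∈ I, d i) (N p) (N q)
      (ζ - ∑ i ∈ I, ε i * jbb α (d i)) (hN q) hle _ ?_
    intro P hP
    obtain ⟨n, hn, rfl⟩ := Finset.mem_image.1 hP
    obtain ⟨hnT, hnd⟩ := Finset.mem_filter.1 hn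
    obtain ⟨hnN, hnζ⟩ := hT n hnT
    refine ⟨hnN p, hnN q, ?_⟩
    have hd : ∀ i ∈ I, d i = n i := fun i hi => by simp [← hnd, hi]
    have hsum : ∑ i ∈ I, d i = ∑ i ∈ I, n i := Finset.sum_congr rfl hd
    have hsum' : ∑ i ∈ I, ε i * jbb α (d i) = ∑ i ∈ I, ε i * jbb α (n i) :=
      Finset.sum_congr rfl fun i hi => by rw [hd i hi]
    rw [hsum, hsum']
    rw [sum_eq_add_add_sum_erase_erase hpq,
      sum_eq_add_add_sum_erase_erase hpq n, ← add_assoc (n p), ← hI] at hnζ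
    convert hnζ using 2
    ring

lemma exists_secondMax_eq {k : ℕ} (N : Fin (k + 2) → ℝ) :
    ∃ p q, p ≠ q ∧ N q ≤ N p ∧ secondMax N = N q := by
  set A := {x : ℝ | ∃ i j : Fin (k + 2), i ≠ j ∧ x = min (N i) (N j)} with hA
  have hfin : A.Finite := by
    refine (Set.finite_range fun ij : Fin (k + 2) × Fin (k + 2) => min (N ij.1) (N ij.2)).subset ?_
    rintro x ⟨i, j, -, rfl⟩
    exact ⟨(i, j), rfl⟩
  have hne : A.Nonempty := ⟨_, 0, 1, by simp, rfl⟩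
  obtain ⟨i, j, hij, h⟩ := hne.csSup_mem hfin
  rcases le_total (N i) (N j) with hle | hle
  · exact ⟨j, i, hij.symm, hle, h.trans (min_eq_left hle)⟩
  · exact ⟨i, j, hij, hle, h.trans (min_eq_right hle)⟩

lemma SimFreq.norm_toE_le {N : ℝ} {n : Fin 3 → ℤ} (hN : 1 ≤ N) (h : SimFreq N n) :
    ‖toE n‖ ≤ N := by
  rw [norm_toE]
  rcases h with h | h
  · exact h.2.2
  · exact h.2.trans hN

lemma IsDyadic.one_le {N : ℝ} (h : IsDyadic N) : 1 ≤ N := by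
  obtain ⟨j, rfl⟩ := h
  exact one_le_pow₀ one_le_two

lemma jbb_neg (α : ℝ) (n : Fin 3 → ℤ) : jbb α (-n) = jbb α n := by
  simp [jbb, jb]

end Tuples

/-- **Counting estimate with a free sum variable** (estimate (CC2) in Remark 3.4),
stated with `k = m + 1` (so `k ≥ 3` ↔ `m ≥ 2`): for `1 < α ≤ 2` there is
`C = C(α,k) > 0`, uniform in the choice of signs, such that for all dyadic
`N_sum, N₁, …, N_{k−1} ≥ 1` and all `ζ ∈ ℝ`, the number of tuples
`(n_sum, n₁, …, n_{k−1})` with `|n_sum| ∼ N_sum`, `|n_j| ∼ N_j`, and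
`|ε_sum ⟪n_sum⟫ + Σ_j ε_j ⟪n_j⟫ + ε_k ⟪n_sum − Σ_j n_j⟫ − ζ| ≤ 1`
is at most `C · (max₍₂₎{N_sum, N₁, …, N_{k−1}})⁻¹ · N_sum³ · Π_j N_j³`. -/
theorem counting_free_sum_variable (α : ℝ) (hα₁ : 1 < α) (hα₂ : α ≤ 2)
    (m : ℕ) (hm : 2 ≤ m) :
    ∃ C : ℝ, 0 < C ∧
      ∀ εsum εk : ℝ, IsSign εsum → IsSign εk → ∀ ε : Fin m → ℝ, (∀ j, IsSign (ε j)) →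
        ∀ Nsum : ℝ, IsDyadic Nsum → ∀ Nv : Fin m → ℝ, (∀ j, IsDyadic (Nv j)) → ∀ ζ : ℝ,
          ∀ S : Set ((Fin 3 → ℤ) × (Fin m → Fin 3 → ℤ)),
            S = {p | SimFreq Nsum p.1 ∧ (∀ j, SimFreq (Nv j) (p.2 j)) ∧
                  |εsum * jbb α p.1 + (∑ j, ε j * jbb α (p.2 j)) +
                    εk * jbb α (p.1 - ∑ j, p.2 j) - ζ| ≤ 1} →
            S.Finite ∧
              (S.ncard : ℝ) ≤
                C * (secondMax (Fin.cons Nsum Nv))⁻¹ * Nsum ^ 3 * ∏ j, Nv j ^ 3 := by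
  obtain ⟨k, rfl⟩ : ∃ k, m = k + 1 := ⟨m - 1, by omega⟩
  obtain ⟨C, hC, hcount⟩ := exists_card_tuple_le hα₁ hα₂ (k + 1 + 1)
  refine ⟨C, hC, ?_⟩
  rintro εsum εk hεsum hεk ε hε Nsum hNsum Nv hNv ζ S rfl
  set N : Fin (k + 1 + 1) → ℝ := Fin.cons Nsum Nv with hN
  set ε' : Fin (k + 1 + 1) → ℝ := Fin.cons εsum ε with hε'
  have hN1 : ∀ i, 1 ≤ N i := Fin.cases hNsum.one_le fun j => (hNv j).one_le
  have hεs : ∀ i, IsSign (ε' i) := Fin.cases hεsum hε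
  obtain ⟨p, q, hpq, hle, hmax⟩ := exists_secondMax_eq N
  set φ : (Fin 3 → ℤ) × (Fin (k + 1) → Fin 3 → ℤ) → Fin (k + 1 + 1) → Fin 3 → ℤ :=
    fun x => Fin.cons x.1 (fun j => -x.2 j) with hφ
  have hφinj : Function.Injective φ := by
    intro x y h
    have h' := Fin.cons_injective2 h
    exact Prod.ext h'.1 (funext fun j => neg_injective (congrFun h'.2 j))
  set T : Set (Fin (k + 1 + 1) → Fin 3 → ℤ) := {n | (∀ i, ‖toE (n i)‖ ≤ N i) ∧
    |∑ i, ε' i * jbb α (n i) + εk * jbb α (∑ i, n i) - ζ| ≤ 1} with hT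
  have hTfin : T.Finite := by
    refine (Fintype.piFinset fun i => latBox (N i)).finite_toSet.subset fun n hn => ?_
    rw [Finset.mem_coe, Fintype.mem_piFinset]
    exact fun i => mem_latBox_of_norm_le (hn.1 i)
  have hmaps : ∀ x, SimFreq Nsum x.1 ∧ (∀ j, SimFreq (Nv j) (x.2 j)) ∧
      |εsum * jbb α x.1 + (∑ j, ε j * jbb α (x.2 j)) + εk * jbb α (x.1 - ∑ j, x.2 j) - ζ| ≤ 1 →
      φ x ∈ T := by
    rintro x ⟨h0, hj, hζ⟩
    refine ⟨fun i => ?_, ?_⟩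
    · refine Fin.cases ?_ (fun j => ?_) i
      · exact h0.norm_toE_le hNsum.one_le
      · simpa [hφ, hN, toE_neg] using (hj j).norm_toE_le (hNv j).one_le
    · rw [Fin.sum_univ_succ, Fin.sum_univ_succ (φ x)]
      simpa [hφ, hε', jbb_neg, sub_eq_add_neg] using hζ
  have himage : φ '' {x | SimFreq Nsum x.1 ∧ (∀ j, SimFreq (Nv j) (x.2 j)) ∧
      |εsum * jbb α x.1 + (∑ j, ε j * jbb α (x.2 j)) + εk * jbb α (x.1 - ∑ j, x.2 j) - ζ| ≤ 1} ⊆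
      T := by
    rintro _ ⟨x, hx, rfl⟩
    exact hmaps x hx
  refine ⟨(hTfin.subset himage).of_finite_image hφinj.injOn, ?_⟩
  have hcard := Set.ncard_le_ncard himage hTfin
  rw [Set.ncard_image_of_injective _ hφinj, Set.ncard_eq_toFinset_card T hTfin] at hcard
  have main := hcount ε' εk hεs hεk N ζ p q hN1 hpq hle hTfin.toFinset
    (fun n hn => hTfin.mem_toFinset.1 hn)
  rw [Fin.prod_univ_succ, ← mul_assoc] at main
  rw [hmax]
  exact le_trans (by exact_mod_cast hcard) main
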